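/- Coupling-time bound for ATO-POS (Proposition 3.2): set α_i = min_{1≤k≤C_i} μ_i(k) and η_i = max_{1≤k≤C_i−1} μ_i(k) (with η_i = 0 if C_i = 1), and suppose {1,…,I} = I_0 ∪ I_C where λ_i < α_i for every i ∈ I_0 and λ_i > η_i for every i ∈ I_C. Then the backward coupling time τ^P = min{t ≥ 0 : |f_P(X, u_t u_{t−1}⋯u_1)| = 1} (the word applies u_t first) satisfies E[τ^P] ≤ Λ (Σ_{i∈I_0} C_i/(α_i − λ_i) + Σ_{i∈I_C} C_i/(λ_i − η_i)). -/

import Mathlib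

open MeasureTheory Finset ENNReal

namespace ATO

/-- Events: joint arrivals `d A` for subsets `A`, and services `s i j`. -/
inductive Ev (I : ℕ) where
  | d : Finset (Fin I) → Ev I
  | s : Fin I → ℕ → Ev I

instance (I : ℕ) : MeasurableSpace (Ev I) := ⊤

/-- Valid events: arrivals for nonempty `A`, services `s i j` with `1 ≤ j ≤ C i`. -/
def ValidEv {I : ℕ} (C : Fin I → ℕ) : Ev I → Prop
  | .d A => A.Nonempty
  | .s i j => 1 ≤ j ∧ j ≤ C i

/-- The state space `X = {0,…,C 1} × ⋯ × {0,…,C I}`. -/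
def Xspace {I : ℕ} (C : Fin I → ℕ) : Set (Fin I → ℕ) := {x | ∀ i, x i ≤ C i}

/-- ATO-POS transition function with individual replenishments. -/
noncomputable def fP {I : ℕ} (C : Fin I → ℕ) (μ : Fin I → ℕ → ℝ) (ℓ : Fin I → ℕ → ℕ)
    (x : Fin I → ℕ) : Ev I → (Fin I → ℕ)
  | .d A => fun k => x k + if k ∈ A ∧ x k < C k then 1 else 0
  | .s i j => fun k => if k = i ∧ μ i (ℓ i j) ≤ μ i (x i) then x k - 1 else x k

/-- ATO-TOS transition function with individual replenishments. -/
noncomputable def fT {I : ℕ} (C : Fin I → ℕ) (μ : Fin I → ℕ → ℝ) (ℓ : Fin I → ℕ → ℕ)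
    (x : Fin I → ℕ) : Ev I → (Fin I → ℕ)
  | .d A => fun k => x k + if k ∈ A ∧ (∀ i ∈ A, x i < C i) then 1 else 0
  | .s i j => fP C μ ℓ x (.s i j)

/-- Iterated application of a transition function along a word (head applied first). -/
def iter {I : ℕ} {σ : Type*} (f : σ → Ev I → σ) : σ → List (Ev I) → σ
  | x, [] => x
  | x, a :: w => iter f (f x a) w

/-- The backward word `u_t u_{t-1} ⋯ u_1` (with `u_t` applied first). -/
def bword {I : ℕ} (ω : ℕ → Ev I) (t : ℕ) : List (Ev I) :=
  ((List.range t).reverse).map fun s => ω (s + 1)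

/-- The forward word `u_1 u_2 ⋯ u_t` (with `u_1` applied first). -/
def fword {I : ℕ} (ω : ℕ → Ev I) (t : ℕ) : List (Ev I) :=
  (List.range t).map fun s => ω (s + 1)

/-- The distribution `ν` on events: `ν (d A) = λ_A / Λ`, `ν (s i j) = (μ_i(ℓ_i^{(j)}) − μ_i(ℓ_i^{(j-1)}))/Λ`. -/
noncomputable def probA {I : ℕ} (C : Fin I → ℕ) (μ : Fin I → ℕ → ℝ) (ℓ : Fin I → ℕ → ℕ)
    (lam : Finset (Fin I) → ℝ) (Λ : ℝ) : Ev I → ℝ≥0∞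
  | .d A => if A.Nonempty then ENNReal.ofReal (lam A / Λ) else 0
  | .s i j => if 1 ≤ j ∧ j ≤ C i then ENNReal.ofReal ((μ i (ℓ i j) - μ i (ℓ i (j - 1))) / Λ) else 0

instance (I : ℕ) : Countable (Ev I) := by
  let g : Ev I → Finset (Fin I) ⊕ (Fin I × ℕ) := fun a =>
    match a with
    | .d A => Sum.inl A
    | .s i j => Sum.inr (i, j)
  have hg : Function.Injective g := by
    intro a b h
    cases a <;> cases b <;> simp_all [g]
  exact hg.countable

section Words

variable {I : ℕ}

theorem bword_succ (ω : ℕ → Ev I) (t : ℕ) :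
    bword ω (t + 1) = ω (t + 1) :: bword ω t := by
  simp [bword, List.range_succ]

theorem bword_eq_iff (ω ω' : ℕ → Ev I) (t : ℕ) :
    bword ω t = bword ω' t ↔ ∀ s ∈ Finset.Icc 1 t, ω s = ω' s := by
  induction t with
  | zero => simp [bword]
  | succ t ih =>
    rw [bword_succ, bword_succ, List.cons.injEq, ih]
    constructor
    · rintro ⟨h1, h2⟩ s hs
      rcases Nat.lt_or_ge s (t + 1) with h | h
      · exact h2 s (by simp at hs ⊢; omega)
      · obtain rfl : s = t + 1 := by simp at hs; omega
        exact h1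
    · intro h
      exact ⟨h _ (by simp), fun s hs => h s (by simp at hs ⊢; omega)⟩

theorem measurableSet_event_eq (n : ℕ) (a : Ev I) :
    MeasurableSet {ω : ℕ → Ev I | ω n = a} :=
  measurable_pi_apply (X := fun _ : ℕ => Ev I) n
    (show MeasurableSet ({a} : Set (Ev I)) from trivial)

theorem measurableSet_bword_eq (t : ℕ) (w : List (Ev I)) :
    MeasurableSet {ω : ℕ → Ev I | bword ω t = w} := by
  by_cases h : ∃ ω₀ : ℕ → Ev I, bword ω₀ t = w
  · obtain ⟨ω₀, rfl⟩ := h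
    have : {ω : ℕ → Ev I | bword ω t = bword ω₀ t}
        = ⋂ s ∈ Finset.Icc 1 t, (fun ω : ℕ → Ev I => ω s) ⁻¹' {ω₀ s} := by
      ext ω
      simp only [Set.mem_ofPred_eq, bword_eq_iff, Set.mem_iInter, Set.mem_preimage,
        Set.mem_singleton_iff]
    rw [this]
    exact Finset.measurableSet_biInter _ fun s _ => measurable_pi_apply s trivial
  · convert MeasurableSet.empty
    ext ω
    simpa using fun h' => h ⟨ω, h'⟩

theorem measurableSet_bword (t : ℕ) (S : Set (List (Ev I))) :
    MeasurableSet {ω : ℕ → Ev I | bword ω t ∈ S} := by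
  have : {ω : ℕ → Ev I | bword ω t ∈ S} = ⋃ w ∈ S, {ω | bword ω t = w} := by
    ext ω; simp
  rw [this]
  exact MeasurableSet.biUnion (Set.to_countable S) fun w _ => measurableSet_bword_eq t w

/-- The trajectory of `f` started at `x` along a word avoids the set `G`. -/
def Avoids {σ : Type*} (f : σ → Ev I → σ) (G : Set σ) : σ → List (Ev I) → Prop
  | x, [] => x ∉ G
  | x, a :: w => x ∉ G ∧ Avoids f G (f x a) w

theorem Avoids.notMem {σ : Type*} {f : σ → Ev I → σ} {G : Set σ} {x : σ} {w : List (Ev I)}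
    (h : Avoids f G x w) : x ∉ G := by
  cases w with
  | nil => exact h
  | cons a w => exact h.1

variable {ν : Ev I → ℝ≥0∞} {P : Measure (ℕ → Ev I)}

theorem measure_cons_bword_eq
    (hiid : ∀ (T : Finset ℕ) (u : ℕ → Ev I), P {ω | ∀ t ∈ T, ω t = u t} = ∏ t ∈ T, ν (u t))
    (t : ℕ) (a : Ev I) (w : List (Ev I)) :
    P {ω | ω (t + 1) = a ∧ bword ω t = w} = ν a * P {ω | bword ω t = w} := by
  by_cases h : ∃ ω₀ : ℕ → Ev I, bword ω₀ t = w
  · obtain ⟨ω₀, rfl⟩ := h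
    have key : ∀ s ∈ Finset.Icc 1 t, Function.update ω₀ (t + 1) a s = ω₀ s := by
      intro s hs
      apply Function.update_of_ne
      simp at hs; omega
    have h1 : {ω : ℕ → Ev I | ω (t + 1) = a ∧ bword ω t = bword ω₀ t}
        = {ω | ∀ s ∈ Finset.Icc 1 (t + 1), ω s = Function.update ω₀ (t + 1) a s} := by
      ext ω
      rw [Set.mem_ofPred_eq, Set.mem_ofPred_eq, ← bword_eq_iff, bword_succ, bword_succ,
        List.cons.injEq, Function.update_self,
        (bword_eq_iff (Function.update ω₀ (t + 1) a) ω₀ t).2 key]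
    have h2 : {ω : ℕ → Ev I | bword ω t = bword ω₀ t}
        = {ω | ∀ s ∈ Finset.Icc 1 t, ω s = ω₀ s} := by
      ext ω; exact bword_eq_iff ω ω₀ t
    rw [h1, h2, hiid, hiid, Finset.prod_Icc_succ_top (by omega), Function.update_self, mul_comm,
      Finset.prod_congr rfl fun s hs => by rw [key s hs]]
  · have h' : ∀ ω : ℕ → Ev I, bword ω t ≠ w := fun ω hω => h ⟨ω, hω⟩
    simp [h']

theorem measure_cons_bword_mem
    (hiid : ∀ (T : Finset ℕ) (u : ℕ → Ev I), P {ω | ∀ t ∈ T, ω t = u t} = ∏ t ∈ T, ν (u t))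
    (t : ℕ) (a : Ev I) (S : Set (List (Ev I))) :
    P {ω | ω (t + 1) = a ∧ bword ω t ∈ S} = ν a * P {ω | bword ω t ∈ S} := by
  have hA : MeasurableSet {ω : ℕ → Ev I | ω (t + 1) = a} :=
    measurableSet_event_eq (t + 1) a
  have h1 := measure_biUnion (μ := P) (Set.to_countable S)
    (f := fun w => {ω : ℕ → Ev I | ω (t + 1) = a ∧ bword ω t = w})
    (fun w _ w' _ hne => Set.disjoint_left.2 fun ω h h' => hne (h.2.symm.trans h'.2))
    (fun w _ => hA.inter (measurableSet_bword_eq t w))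
  have h2 := measure_biUnion (μ := P) (Set.to_countable S)
    (f := fun w => {ω : ℕ → Ev I | bword ω t = w})
    (fun w _ w' _ hne => Set.disjoint_left.2 fun ω h h' => hne (h.symm.trans h'))
    (fun w _ => measurableSet_bword_eq t w)
  have e1 : {ω : ℕ → Ev I | ω (t + 1) = a ∧ bword ω t ∈ S}
      = ⋃ w ∈ S, {ω : ℕ → Ev I | ω (t + 1) = a ∧ bword ω t = w} := by
    ext ω; simp
  have e2 : {ω : ℕ → Ev I | bword ω t ∈ S} = ⋃ w ∈ S, {ω : ℕ → Ev I | bword ω t = w} := by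
    ext ω; simp
  rw [e1, e2, h1, h2, ← ENNReal.tsum_mul_left]
  exact tsum_congr fun w => measure_cons_bword_eq hiid t a w

theorem tsum_event_prob [IsProbabilityMeasure P]
    (hiid : ∀ (T : Finset ℕ) (u : ℕ → Ev I), P {ω | ∀ t ∈ T, ω t = u t} = ∏ t ∈ T, ν (u t)) :
    ∑' a, ν a = 1 := by
  have h := measure_iUnion (μ := P) (f := fun a : Ev I => {ω : ℕ → Ev I | ω 0 = a})
    (fun a b hne => Set.disjoint_left.2 fun ω h h' => hne (h.symm.trans h'))
    (fun a => measurableSet_event_eq 0 a)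
  have e : (⋃ a : Ev I, {ω : ℕ → Ev I | ω 0 = a}) = Set.univ := by
    ext ω; simp
  rw [e, measure_univ] at h
  rw [h]
  refine tsum_congr fun a => ?_
  simpa using (hiid {0} fun _ => a).symm

theorem measure_avoids_succ_le
    (hiid : ∀ (T : Finset ℕ) (u : ℕ → Ev I), P {ω | ∀ t ∈ T, ω t = u t} = ∏ t ∈ T, ν (u t))
    {σ : Type*} (f : σ → Ev I → σ) (G : Set σ) (x : σ) (t : ℕ) :
    P {ω | Avoids f G x (bword ω (t + 1))}
      ≤ ∑' a, ν a * P {ω | Avoids f G (f x a) (bword ω t)} := by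
  have hsub : {ω : ℕ → Ev I | Avoids f G x (bword ω (t + 1))}
      ⊆ ⋃ a, {ω | ω (t + 1) = a ∧ bword ω t ∈ {w | Avoids f G (f x a) w}} := by
    intro ω hω
    rw [Set.mem_ofPred_eq, bword_succ] at hω
    exact Set.mem_iUnion.2 ⟨ω (t + 1), rfl, hω.2⟩
  refine (measure_mono hsub).trans ((measure_iUnion_le _).trans (le_of_eq ?_))
  exact tsum_congr fun a => measure_cons_bword_mem hiid t a _

/-- A Foster–Lyapunov bound on the expected time spent before entering `G`. -/
theorem tsum_measure_avoids_le [IsProbabilityMeasure P]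
    (hiid : ∀ (T : Finset ℕ) (u : ℕ → Ev I), P {ω | ∀ t ∈ T, ω t = u t} = ∏ t ∈ T, ν (u t))
    {σ : Type*} (f : σ → Ev I → σ)
    (G S : Set σ) (V : σ → ℝ≥0∞) (hS : ∀ x ∈ S, ∀ a, f x a ∈ S)
    (hV : ∀ x ∈ S, x ∉ G → 1 + ∑' a, ν a * V (f x a) ≤ V x) (x : σ) (hx : x ∈ S) :
    ∑' t, P {ω | Avoids f G x (bword ω t)} ≤ V x := by
  refine ENNReal.tsum_le_of_sum_range_le fun T => ?_
  induction T generalizing x with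
  | zero => simp
  | succ T ih =>
    by_cases hG : x ∈ G
    · have h0 : ∀ t, {ω : ℕ → Ev I | Avoids f G x (bword ω t)} = ∅ := fun t =>
        Set.eq_empty_of_forall_notMem fun ω hω => hω.notMem hG
      simp [h0]
    · refine le_trans ?_ (hV x hx hG)
      rw [Finset.sum_range_succ', add_comm]
      refine add_le_add prob_le_one ?_
      calc _ ≤ ∑ t ∈ Finset.range T, ∑' a, ν a * P {ω | Avoids f G (f x a) (bword ω t)} :=
            Finset.sum_le_sum fun t _ => measure_avoids_succ_le hiid f G x t
        _ = ∑' a, ν a * ∑ t ∈ Finset.range T, P {ω | Avoids f G (f x a) (bword ω t)} := by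
            simp_rw [Finset.mul_sum]
            exact (Summable.tsum_finsetSum fun _ _ => ENNReal.summable).symm
        _ ≤ _ := ENNReal.tsum_le_tsum fun a => by
            gcongr
            exact ih _ (hS x hx a)

end Words

section Dynamics

variable {I : ℕ} {C : Fin I → ℕ} {μ : Fin I → ℕ → ℝ} {ℓ : Fin I → ℕ → ℕ}

theorem fP_le {x : Fin I → ℕ} {i : Fin I} (hx : x i ≤ C i) (a : Ev I) : fP C μ ℓ x a i ≤ C i := by
  cases a <;> simp only [fP] <;> split_ifs <;> omega

theorem fP_congr {x y : Fin I → ℕ} {i : Fin I} (h : x i = y i) (a : Ev I) :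
    fP C μ ℓ x a i = fP C μ ℓ y a i := by
  cases a with
  | d A => simp only [fP, h]
  | s k j =>
    by_cases hk : i = k
    · subst hk; simp only [fP, h]
    · simp [fP, h, hk]

theorem fP_mono {x y : Fin I → ℕ} {i : Fin I} (h : x i ≤ y i) (a : Ev I) :
    fP C μ ℓ x a i ≤ fP C μ ℓ y a i := by
  rcases h.eq_or_lt with h | h
  · exact (fP_congr h a).le
  · cases a <;> simp only [fP] <;> split_ifs <;> omega

theorem iter_fP_congr {x y : Fin I → ℕ} {i : Fin I} (h : x i = y i) (w : List (Ev I)) :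
    iter (fP C μ ℓ) x w i = iter (fP C μ ℓ) y w i := by
  induction w generalizing x y with
  | nil => exact h
  | cons a w ih => exact ih (fP_congr h a)

theorem iter_eq_of_upper_hits {x y : Fin I → ℕ} {i : Fin I} (h : x i ≤ y i) (hy : y i ≤ C i)
    (w : List (Ev I)) (hw : ¬ Avoids (fP C μ ℓ) {z | z i = 0} y w) :
    iter (fP C μ ℓ) x w i = iter (fP C μ ℓ) y w i := by
  by_cases hG : y i = 0
  · exact iter_fP_congr (by omega) w
  · induction w generalizing x y with
    | nil => exact absurd hG hw
    | cons a w ih =>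
      have hw' : ¬ Avoids (fP C μ ℓ) {z | z i = 0} (fP C μ ℓ y a) w := fun h' => hw ⟨hG, h'⟩
      have hm := fP_mono (C := C) (μ := μ) (ℓ := ℓ) h a
      by_cases hGa : fP C μ ℓ y a i = 0
      · exact iter_fP_congr (by omega) w
      · exact ih hm (fP_le hy a) hw' hGa

theorem iter_eq_of_lower_hits {x y : Fin I → ℕ} {i : Fin I} (h : x i ≤ y i) (hy : y i ≤ C i)
    (w : List (Ev I)) (hw : ¬ Avoids (fP C μ ℓ) {z | z i = C i} x w) :
    iter (fP C μ ℓ) x w i = iter (fP C μ ℓ) y w i := by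
  by_cases hG : x i = C i
  · exact iter_fP_congr (by omega) w
  · induction w generalizing x y with
    | nil => exact absurd hG hw
    | cons a w ih =>
      have hw' : ¬ Avoids (fP C μ ℓ) {z | z i = C i} (fP C μ ℓ x a) w := fun h' => hw ⟨hG, h'⟩
      have hm := fP_mono (C := C) (μ := μ) (ℓ := ℓ) h a
      have hc := fP_le (μ := μ) (ℓ := ℓ) hy a
      by_cases hGa : fP C μ ℓ x a i = C i
      · exact iter_fP_congr (by omega) w
      · exact ih hm hc hw' hGa

/-- A word coalesces as soon as, in each coordinate, the maximal trajectory has emptied or the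
minimal trajectory has filled up. -/
theorem exists_image_eq_singleton {I0 IC : Finset (Fin I)} (hcover : I0 ∪ IC = Finset.univ)
    (w : List (Ev I)) (h0 : ∀ i ∈ I0, ¬ Avoids (fP C μ ℓ) {z | z i = 0} C w)
    (hc : ∀ i ∈ IC, ¬ Avoids (fP C μ ℓ) {z | z i = C i} 0 w) :
    ∃ c : Fin I → ℕ, (fun x => iter (fP C μ ℓ) x w) '' Xspace C = {c} := by
  refine ⟨iter (fP C μ ℓ) C w, Set.eq_singleton_iff_unique_mem.2
    ⟨⟨C, fun i => le_rfl, rfl⟩, ?_⟩⟩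
  rintro _ ⟨x, hx, rfl⟩
  funext i
  have hi : i ∈ I0 ∪ IC := by rw [hcover]; exact Finset.mem_univ i
  rcases Finset.mem_union.1 hi with hi | hi
  · exact iter_eq_of_upper_hits (hx i) le_rfl w (h0 i hi)
  · exact (iter_eq_of_lower_hits (Nat.zero_le _) (hx i) w (hc i hi)).symm.trans
      (iter_eq_of_lower_hits (Nat.zero_le _) le_rfl w (hc i hi))

variable {lam : Finset (Fin I) → ℝ} {Λ : ℝ}

theorem tsum_down (hμ0 : ∀ i, μ i 0 = 0) (hμnn : ∀ i k, k ≤ C i → 0 ≤ μ i k)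
    (hℓ : ∀ i, Set.BijOn (ℓ i) (Set.Iic (C i)) (Set.Iic (C i)))
    (hsort : ∀ i j, j < C i → μ i (ℓ i j) ≤ μ i (ℓ i (j + 1))) (hΛpos : 0 < Λ)
    {x : Fin I → ℕ} {i : Fin I} (hx : x i ≤ C i) :
    ∑' a, probA C μ ℓ lam Λ a * ((x i - fP C μ ℓ x a i : ℕ) : ℝ≥0∞)
      = ENNReal.ofReal (μ i (x i) / Λ) := by
  rcases Nat.eq_zero_or_pos (x i) with h0 | hpos
  · simp [h0, hμ0]
  have hmono : ∀ j k, j ≤ k → k ≤ C i → μ i (ℓ i j) ≤ μ i (ℓ i k) := by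
    intro j k hjk
    induction k, hjk using Nat.le_induction with
    | base => intro _; exact le_rfl
    | succ k _ ih => intro hk; exact (ih (by omega)).trans (hsort i k (by omega))
  have hbase : μ i (ℓ i 0) = 0 := by
    obtain ⟨m, hm, hm0⟩ := (hℓ i).surjOn (Set.mem_Iic.2 (Nat.zero_le (C i)))
    refine le_antisymm ?_ (hμnn i _ ((hℓ i).mapsTo (Set.mem_Iic.2 (Nat.zero_le (C i)))))
    have := hmono 0 m (Nat.zero_le _) hm
    rwa [hm0, hμ0] at this
  obtain ⟨k, hk, hkx⟩ := (hℓ i).surjOn (Set.mem_Iic.2 hx)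
  rw [Set.mem_Iic] at hk
  have hinj : Function.Injective (Ev.s i) := fun a b h => by simpa using h
  rw [tsum_eq_sum (s := (Finset.Icc 1 k).map ⟨Ev.s i, hinj⟩), Finset.sum_map]
  · have hterm : ∀ j ∈ Finset.Icc 1 k,
        probA C μ ℓ lam Λ (Ev.s i j) * ((x i - fP C μ ℓ x (Ev.s i j) i : ℕ) : ℝ≥0∞)
          = ENNReal.ofReal ((μ i (ℓ i j) - μ i (ℓ i (j - 1))) / Λ) := by
      intro j hj
      rw [Finset.mem_Icc] at hj
      have hle : μ i (ℓ i j) ≤ μ i (x i) := hkx ▸ hmono j k hj.2 hk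
      have hd : x i - fP C μ ℓ x (Ev.s i j) i = 1 := by
        simp only [fP, hle, and_self, if_true]; omega
      rw [hd, probA, if_pos ⟨hj.1, hj.2.trans hk⟩]
      simp
    have hnn : ∀ j ∈ Finset.Icc 1 k, 0 ≤ (μ i (ℓ i j) - μ i (ℓ i (j - 1))) / Λ := by
      intro j hj
      rw [Finset.mem_Icc] at hj
      exact div_nonneg (sub_nonneg.2 (hmono _ _ (by omega) (by omega))) hΛpos.le
    simp only [Function.Embedding.coeFn_mk]
    rw [Finset.sum_congr rfl hterm, ← ENNReal.ofReal_sum_of_nonneg hnn, ← Finset.sum_div]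
    congr 2
    have htel : ∀ n, ∑ j ∈ Finset.Icc 1 n, (μ i (ℓ i j) - μ i (ℓ i (j - 1))) = μ i (ℓ i n) := by
      intro n
      induction n with
      | zero => simp [hbase]
      | succ n ih => rw [Finset.sum_Icc_succ_top (by omega), ih]; simp
    rw [htel, hkx]
  · intro a ha
    cases a with
    | d A =>
      have : x i - fP C μ ℓ x (Ev.d A) i = 0 := by simp [fP]
      simp [this]
    | s m j =>
      by_cases hm : i = m
      · subst hm
        have hj : ¬ (1 ≤ j ∧ j ≤ k) := by simpa using ha
        by_cases hjC : 1 ≤ j ∧ j ≤ C i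
        · by_cases hle : μ i (ℓ i j) ≤ μ i (x i)
          · have h1 : μ i (ℓ i k) ≤ μ i (ℓ i (j - 1)) := hmono _ _ (by omega) (by omega)
            have h2 : (μ i (ℓ i j) - μ i (ℓ i (j - 1))) / Λ ≤ 0 :=
              div_nonpos_of_nonpos_of_nonneg (by rw [hkx] at h1; linarith) hΛpos.le
            simp [probA, hjC, ENNReal.ofReal_of_nonpos h2]
          · simp [fP, hle]
        · simp [probA, hjC]
      · simp [fP, hm]

theorem tsum_up (hlamnn : ∀ A, 0 ≤ lam A) (hΛpos : 0 < Λ) {x : Fin I → ℕ} {i : Fin I} :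
    ∑' a, probA C μ ℓ lam Λ a * ((fP C μ ℓ x a i - x i : ℕ) : ℝ≥0∞)
      = if x i < C i then
          ENNReal.ofReal ((∑ A ∈ Finset.univ.filter (fun A => i ∈ A), lam A) / Λ) else 0 := by
  have hinj : Function.Injective (Ev.d (I := I)) := fun a b h => by simpa using h
  rw [tsum_eq_sum (s := (Finset.univ.filter (fun A : Finset (Fin I) => i ∈ A)).map ⟨Ev.d, hinj⟩),
    Finset.sum_map]
  · split_ifs with h
    · rw [Finset.sum_div, ENNReal.ofReal_sum_of_nonneg fun A _ => div_nonneg (hlamnn A) hΛpos.le]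
      refine Finset.sum_congr rfl fun A hA => ?_
      have hA' : i ∈ A := by simpa using hA
      have hne : A.Nonempty := ⟨i, hA'⟩
      simp [probA, fP, hA', hne, h]
    · exact Finset.sum_eq_zero fun A _ => by simp [fP, h]
  · intro a ha
    cases a with
    | d A =>
      have hA : i ∉ A := by simpa using ha
      simp [fP, hA]
    | s m j =>
      have : fP C μ ℓ x (Ev.s m j) i - x i = 0 := by
        simp only [fP]; split_ifs <;> omega
      simp [this]

end Dynamics

/-- A drift inequality from a balance of upward mass `p` and downward mass `q`. -/
theorem drift_of_balance {E v : ℝ≥0∞} {p q Λ : ℝ} (hΛ : 0 < Λ) (hp : 0 ≤ p)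
    {δ : ℝ} (hδ : 0 < δ) (hδ' : δ ≤ q - p)
    (h : E + ENNReal.ofReal (q / Λ) = v + ENNReal.ofReal (p / Λ)) :
    1 + ENNReal.ofReal (Λ / δ) * E ≤ ENNReal.ofReal (Λ / δ) * v := by
  have hfin : ENNReal.ofReal (Λ / δ) * ENNReal.ofReal (p / Λ) ≠ ∞ :=
    ENNReal.mul_ne_top ENNReal.ofReal_ne_top ENNReal.ofReal_ne_top
  have hq : 1 + ENNReal.ofReal (Λ / δ) * ENNReal.ofReal (p / Λ)
      ≤ ENNReal.ofReal (Λ / δ) * ENNReal.ofReal (q / Λ) := by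
    rw [← ENNReal.ofReal_mul (by positivity), ← ENNReal.ofReal_mul (by positivity),
      ← ENNReal.ofReal_one, ← ENNReal.ofReal_add zero_le_one (by positivity)]
    apply ENNReal.ofReal_le_ofReal
    have e1 : Λ / δ * (p / Λ) = p / δ := by field_simp
    have e2 : Λ / δ * (q / Λ) = q / δ := by field_simp
    rw [e1, e2, ← sub_nonneg, show q / δ - (1 + p / δ) = (q - p - δ) / δ by field_simp; ring]
    exact div_nonneg (by linarith) hδ.le
  refine (ENNReal.add_le_add_iff_right hfin).1 ?_
  calc _ = ENNReal.ofReal (Λ / δ) * E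
        + (1 + ENNReal.ofReal (Λ / δ) * ENNReal.ofReal (p / Λ)) := by ring
    _ ≤ ENNReal.ofReal (Λ / δ) * E + ENNReal.ofReal (Λ / δ) * ENNReal.ofReal (q / Λ) := by
      gcongr
    _ = _ := by rw [← mul_add, h, mul_add]

/-- The first time a predicate holds is at most the number of times at which it fails. -/
theorem sInf_le_tsum_indicator {Ω : Type*} (B : ℕ → Set Ω) (ω : Ω) :
    sInf {r : ℝ≥0∞ | ∃ t : ℕ, r = t ∧ ω ∉ B t} ≤ ∑' t, (B t).indicator 1 ω := by
  classical
  by_cases h : ∃ t, ω ∉ B t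
  · have hmem : (Nat.find h : ℝ≥0∞) ∈ {r : ℝ≥0∞ | ∃ t : ℕ, r = t ∧ ω ∉ B t} :=
      ⟨Nat.find h, rfl, Nat.find_spec h⟩
    refine (sInf_le hmem).trans ?_
    refine le_trans (le_of_eq ?_) (ENNReal.sum_le_tsum (Finset.range (Nat.find h)))
    rw [Finset.sum_congr rfl (g := fun _ => 1)]
    · simp
    · intro t ht
      have : ω ∈ B t := not_not.1 (Nat.find_min h (Finset.mem_range.1 ht))
      simp [this]
  · push Not at h
    simp [h]

/-- Proposition 3.2: coupling-time bound for ATO-POS. -/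
theorem stmt4 (I : ℕ) (hI : 1 ≤ I) (C : Fin I → ℕ) (hC : ∀ i, 1 ≤ C i)
    (μ : Fin I → ℕ → ℝ) (hμ0 : ∀ i, μ i 0 = 0) (hμnn : ∀ i k, k ≤ C i → 0 ≤ μ i k)
    (ℓ : Fin I → ℕ → ℕ) (hℓ : ∀ i, Set.BijOn (ℓ i) (Set.Iic (C i)) (Set.Iic (C i)))
    (hsort : ∀ i j, j < C i → μ i (ℓ i j) ≤ μ i (ℓ i (j + 1)))
    (lam : Finset (Fin I) → ℝ) (hlamnn : ∀ A, 0 ≤ lam A) (hlam0 : lam ∅ = 0)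
    (β : Fin I → ℝ) (hβ : ∀ i, IsGreatest (μ i '' Set.Iic (C i)) (β i))
    (Λ : ℝ) (hΛ : Λ = (∑ A : Finset (Fin I), lam A) + ∑ i, β i) (hΛpos : 0 < Λ)
    (lamI : Fin I → ℝ)
    (hlamI : ∀ i, lamI i = ∑ A ∈ Finset.univ.filter (fun A => i ∈ A), lam A)
    (P : Measure (ℕ → Ev I)) [IsProbabilityMeasure P]
    (hiid : ∀ (T : Finset ℕ) (u : ℕ → Ev I),
        P {ω | ∀ t ∈ T, ω t = u t} = ∏ t ∈ T, probA C μ ℓ lam Λ (u t))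
    (α η : Fin I → ℝ)
    (hα : ∀ i, IsLeast (μ i '' Set.Icc 1 (C i)) (α i))
    (hη1 : ∀ i, C i = 1 → η i = 0)
    (hη2 : ∀ i, 2 ≤ C i → IsGreatest (μ i '' Set.Icc 1 (C i - 1)) (η i))
    (I0 IC : Finset (Fin I)) (hcover : I0 ∪ IC = Finset.univ)
    (hI0 : ∀ i ∈ I0, lamI i < α i) (hIC : ∀ i ∈ IC, η i < lamI i) :
    ∫⁻ ω, sInf {r : ℝ≥0∞ | ∃ t : ℕ, r = t ∧
        ∃ c : Fin I → ℕ, (fun x => iter (fP C μ ℓ) x (bword ω t)) '' Xspace C = {c}} ∂P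
      ≤ ENNReal.ofReal (Λ * (∑ i ∈ I0, (C i : ℝ) / (α i - lamI i)
          + ∑ i ∈ IC, (C i : ℝ) / (lamI i - η i))) := by
  have hν := tsum_event_prob hiid
  have hS : ∀ x ∈ Xspace C, ∀ a, fP C μ ℓ x a ∈ Xspace C := fun x hx a i => fP_le (hx i) a
  have hlamI0 : ∀ i, 0 ≤ lamI i := fun i => by
    rw [hlamI]; exact Finset.sum_nonneg fun A _ => hlamnn A
  have hup : ∀ (x : Fin I → ℕ) i,
      ∑' a, probA C μ ℓ lam Λ a * ((fP C μ ℓ x a i - x i : ℕ) : ℝ≥0∞)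
        = if x i < C i then ENNReal.ofReal (lamI i / Λ) else 0 := fun x i => by
    rw [hlamI]; exact tsum_up hlamnn hΛpos
  have hdown : ∀ x ∈ Xspace C, ∀ i,
      ∑' a, probA C μ ℓ lam Λ a * ((x i - fP C μ ℓ x a i : ℕ) : ℝ≥0∞)
        = ENNReal.ofReal (μ i (x i) / Λ) := fun x hx i =>
    tsum_down hμ0 hμnn hℓ hsort hΛpos (hx i)
  have hηnn : ∀ i, 0 ≤ η i := by
    intro i
    rcases (hC i).eq_or_lt with h | h
    · exact (hη1 i h.symm).ge
    · obtain ⟨k, hk, hkη⟩ := (hη2 i h).1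
      exact hkη ▸ hμnn i k (by rw [Set.mem_Icc] at hk; omega)
  have hbal : ∀ (V : (Fin I → ℕ) → ℕ) (x : Fin I → ℕ) (U D : Ev I → ℕ),
      (∀ a, V (fP C μ ℓ x a) + D a = V x + U a) →
      ∑' a, probA C μ ℓ lam Λ a * (V (fP C μ ℓ x a) : ℝ≥0∞)
        + ∑' a, probA C μ ℓ lam Λ a * (D a : ℝ≥0∞)
        = V x + ∑' a, probA C μ ℓ lam Λ a * (U a : ℝ≥0∞) := by
    intro V x U D h
    have hone : (V x : ℝ≥0∞) = ∑' a, probA C μ ℓ lam Λ a * (V x : ℝ≥0∞) := by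
      rw [ENNReal.tsum_mul_right, hν, one_mul]
    rw [hone, ← ENNReal.tsum_add, ← ENNReal.tsum_add]
    refine tsum_congr fun a => ?_
    rw [← mul_add, ← mul_add]
    congr 1
    exact_mod_cast h a
  have hb0 : ∀ i ∈ I0, ∑' t, P {ω | Avoids (fP C μ ℓ) {z | z i = 0} C (bword ω t)}
      ≤ ENNReal.ofReal (Λ / (α i - lamI i)) * (C i : ℝ≥0∞) := by
    intro i hi
    refine tsum_measure_avoids_le hiid (fP C μ ℓ) {z | z i = 0} (Xspace C)
      (fun x => ENNReal.ofReal (Λ / (α i - lamI i)) * (x i : ℝ≥0∞)) hS ?_ C (fun _ => le_rfl)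
    intro x hx hxG
    have hαx : α i ≤ μ i (x i) :=
      (hα i).2 ⟨x i, ⟨Nat.one_le_iff_ne_zero.2 hxG, hx i⟩, rfl⟩
    have hlt := hI0 i hi
    have key := hbal (fun z => z i) x (fun a => fP C μ ℓ x a i - x i)
      (fun a => x i - fP C μ ℓ x a i) (fun a => by omega)
    rw [hdown x hx, hup] at key
    simp_rw [mul_left_comm _ (ENNReal.ofReal (Λ / (α i - lamI i))), ENNReal.tsum_mul_left]
    split_ifs at key with hxC
    · exact drift_of_balance hΛpos (hlamI0 i) (by linarith) (by linarith) key
    · exact drift_of_balance (p := 0) (q := μ i (x i)) hΛpos le_rfl (by linarith)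
        (by linarith [hlamI0 i]) (by simpa using key)
  have hbC : ∀ i ∈ IC, ∑' t, P {ω | Avoids (fP C μ ℓ) {z | z i = C i} 0 (bword ω t)}
      ≤ ENNReal.ofReal (Λ / (lamI i - η i)) * (C i : ℝ≥0∞) := by
    intro i hi
    refine tsum_measure_avoids_le hiid (fP C μ ℓ) {z | z i = C i} (Xspace C)
      (fun x => ENNReal.ofReal (Λ / (lamI i - η i)) * ((C i - x i : ℕ) : ℝ≥0∞)) hS ?_ 0
      (fun _ => Nat.zero_le _)
    intro x hx hxG
    have hxC : x i < C i := lt_of_le_of_ne (hx i) hxG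
    have hμx : μ i (x i) ≤ η i := by
      rcases Nat.eq_zero_or_pos (x i) with h | h
      · rw [h, hμ0]; exact hηnn i
      · exact (hη2 i (by omega)).2 ⟨x i, ⟨h, by omega⟩, rfl⟩
    have hlt := hIC i hi
    have key := hbal (fun z => C i - z i) x
      (fun a => x i - fP C μ ℓ x a i) (fun a => fP C μ ℓ x a i - x i) (fun a => by
        have := hx i
        have := hS x hx a i
        omega)
    rw [hdown x hx, hup, if_pos hxC] at key
    simp_rw [mul_left_comm _ (ENNReal.ofReal (Λ / (lamI i - η i))), ENNReal.tsum_mul_left]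
    exact drift_of_balance hΛpos (hμnn i _ (hx i)) (by linarith) (by linarith) key
  let B : ℕ → Set (ℕ → Ev I) := fun t =>
    {ω | ¬ ∃ c : Fin I → ℕ, (fun x => iter (fP C μ ℓ) x (bword ω t)) '' Xspace C = {c}}
  have hBmeas : ∀ t, MeasurableSet (B t) := fun t => measurableSet_bword t
    {w | ¬ ∃ c : Fin I → ℕ, (fun x => iter (fP C μ ℓ) x w) '' Xspace C = {c}}
  have hBle : ∀ t, P (B t) ≤ ∑ i ∈ I0, P {ω | Avoids (fP C μ ℓ) {z | z i = 0} C (bword ω t)}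
      + ∑ i ∈ IC, P {ω | Avoids (fP C μ ℓ) {z | z i = C i} 0 (bword ω t)} := by
    intro t
    have hsub : B t ⊆ (⋃ i ∈ I0, {ω | Avoids (fP C μ ℓ) {z | z i = 0} C (bword ω t)})
        ∪ ⋃ i ∈ IC, {ω | Avoids (fP C μ ℓ) {z | z i = C i} 0 (bword ω t)} := by
      intro ω hω
      by_contra hcon
      simp only [Set.mem_union, Set.mem_iUnion, Set.mem_ofPred_eq, not_or, not_exists] at hcon
      exact hω (exists_image_eq_singleton hcover _ (fun i hi => hcon.1 i hi)
        fun i hi => hcon.2 i hi)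
    refine (measure_mono hsub).trans ((measure_union_le _ _).trans ?_)
    exact add_le_add (measure_biUnion_finset_le _ _) (measure_biUnion_finset_le _ _)
  calc _ ≤ ∫⁻ ω, ∑' t, (B t).indicator 1 ω ∂P := by
        refine lintegral_mono fun ω => ?_
        simpa [B] using sInf_le_tsum_indicator B ω
    _ = ∑' t, P (B t) := by
        rw [lintegral_tsum fun t => (measurable_one.indicator (hBmeas t)).aemeasurable]
        exact tsum_congr fun t => lintegral_indicator_one (hBmeas t)
    _ ≤ ∑' t, (∑ i ∈ I0, P {ω | Avoids (fP C μ ℓ) {z | z i = 0} C (bword ω t)}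
          + ∑ i ∈ IC, P {ω | Avoids (fP C μ ℓ) {z | z i = C i} 0 (bword ω t)}) :=
        ENNReal.tsum_le_tsum hBle
    _ = ∑ i ∈ I0, ∑' t, P {ω | Avoids (fP C μ ℓ) {z | z i = 0} C (bword ω t)}
          + ∑ i ∈ IC, ∑' t, P {ω | Avoids (fP C μ ℓ) {z | z i = C i} 0 (bword ω t)} := by
        rw [ENNReal.tsum_add, Summable.tsum_finsetSum fun _ _ => ENNReal.summable,
          Summable.tsum_finsetSum fun _ _ => ENNReal.summable]
    _ ≤ ∑ i ∈ I0, ENNReal.ofReal (Λ * ((C i : ℝ) / (α i - lamI i)))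
          + ∑ i ∈ IC, ENNReal.ofReal (Λ * ((C i : ℝ) / (lamI i - η i))) := by
        have hconv : ∀ (δ : ℝ) (n : ℕ), 0 < δ →
            ENNReal.ofReal (Λ / δ) * (n : ℝ≥0∞) = ENNReal.ofReal (Λ * ((n : ℝ) / δ)) := by
          intro δ n hδ
          rw [← ENNReal.ofReal_natCast, ← ENNReal.ofReal_mul (by positivity)]
          congr 1
          ring
        refine add_le_add (Finset.sum_le_sum fun i hi => ?_) (Finset.sum_le_sum fun i hi => ?_)
        · rw [← hconv _ _ (sub_pos.2 (hI0 i hi))]; exact hb0 i hi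
        · rw [← hconv _ _ (sub_pos.2 (hIC i hi))]; exact hbC i hi
    _ = _ := by
        have n0 : ∀ i ∈ I0, 0 ≤ Λ * ((C i : ℝ) / (α i - lamI i)) := fun i hi =>
          mul_nonneg hΛpos.le (div_nonneg (Nat.cast_nonneg _) (sub_pos.2 (hI0 i hi)).le)
        have nC : ∀ i ∈ IC, 0 ≤ Λ * ((C i : ℝ) / (lamI i - η i)) := fun i hi =>
          mul_nonneg hΛpos.le (div_nonneg (Nat.cast_nonneg _) (sub_pos.2 (hIC i hi)).le)
        rw [mul_add, Finset.mul_sum, Finset.mul_sum,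
          ENNReal.ofReal_add (Finset.sum_nonneg n0) (Finset.sum_nonneg nC),
          ENNReal.ofReal_sum_of_nonneg n0, ENNReal.ofReal_sum_of_nonneg nC]

end ATO
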